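/- For every A ≥ 1 there exist constants C₄, C₅ > 0 depending only on A with the following property. Let n ≥ 2 and let Ω : ℝⁿ∖{0} → ℝ be a measurable odd function that is homogeneous of degree zero (Ω(δx) = Ω(x) for all x ≠ 0 and δ > 0), is integrable on the unit sphere S^{n−1} with ∫_{S^{n−1}} Ω(θ) dσ(θ) = 0, and satisfies ∫_{S^{n−1}} |Ω(θ − ξδ) − Ω(θ)| dσ(θ) ≤ A n δ ∫_{S^{n−1}} |Ω(θ)| dσ(θ) for all ξ ∈ S^{n−1} and 0 < δ < 1/n. Set K(x) := Ω(x)/|x|ⁿ. Then for every λ > 0, every continuous compactly supported f : ℝⁿ → ℝ, and every measurable g : ℝⁿ → ℝ with g(x) = lim_{ε→0⁺} ∫_{|x−y|≥ε} K(x−y) f(y) dy for almost every x, one has |{x : |g(x)| > λ}| ≤ (C₄ + C₅ ‖Ω‖_{L¹(S^{n−1},σ)}) (1/λ)‖f‖_{L¹(ℝⁿ)} + 2 sup_ν |{x : |Tν(x)| > λ}|, where the supremum is over measures ν = Σ_{k=1}^N a_k δ_{c_k} with N ∈ ℕ, c_k ∈ ℝⁿ, a_k > 0, Σ_{k=1}^N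 a_k ≤ 16‖f‖_{L¹(ℝⁿ)}, and Tν(x) := Σ_{k=1}^N a_k K(x − c_k). -/

import Mathlib

open MeasureTheory Filter Set Metric

theorem abs_integral_sin_div_le_of_one_le {a b : ℝ} (ha : 1 ≤ a) (hab : a ≤ b) :
    |∫ u in a..b, Real.sin u / u| ≤ 3 := by
  have hpos : ∀ u ∈ uIcc a b, 0 < u := by
    intro u hu
    rw [uIcc_of_le hab] at hu
    linarith [hu.1]
  have hd : ∀ u ∈ uIcc a b,
      HasDerivAt (fun u => -Real.cos u / u) (Real.sin u / u + Real.cos u / u ^ 2) u := by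
    intro u hu
    have hu0 := (hpos u hu).ne'
    have := (Real.hasDerivAt_cos u).neg.div (hasDerivAt_id u) hu0
    refine this.congr_deriv ?_
    simp only [id, Pi.neg_apply]
    field_simp
    ring
  have hc1 : IntervalIntegrable (fun u => Real.sin u / u) volume a b :=
    ContinuousOn.intervalIntegrable
      (Real.continuous_sin.continuousOn.div continuousOn_id fun u hu => (hpos u hu).ne')
  have hc2 : IntervalIntegrable (fun u => Real.cos u / u ^ 2) volume a b :=
    ContinuousOn.intervalIntegrable
      (Real.continuous_cos.continuousOn.div (continuousOn_id.pow 2)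
        fun u hu => (pow_pos (hpos u hu) 2).ne')
  have hc3 : IntervalIntegrable (fun u : ℝ => 1 / u ^ 2) volume a b :=
    ContinuousOn.intervalIntegrable
      (continuousOn_const.div (continuousOn_id.pow 2)
        fun u hu => (pow_pos (hpos u hu) 2).ne')
  have h1 := intervalIntegral.integral_eq_sub_of_hasDerivAt hd (hc1.add hc2)
  rw [intervalIntegral.integral_add hc1 hc2] at h1
  have hd3 : ∀ u ∈ uIcc a b, HasDerivAt (fun u : ℝ => -1 / u) (1 / u ^ 2) u := by
    intro u hu
    have hu0 := (hpos u hu).ne'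
    have := (hasDerivAt_const u (-1 : ℝ)).div (hasDerivAt_id u) hu0
    refine this.congr_deriv ?_
    simp
  have h3 := intervalIntegral.integral_eq_sub_of_hasDerivAt hd3 hc3
  have h2 : |∫ u in a..b, Real.cos u / u ^ 2| ≤ ∫ u in a..b, 1 / u ^ 2 := by
    rw [← Real.norm_eq_abs]
    refine intervalIntegral.norm_integral_le_of_norm_le hab (ae_of_all _ fun u hu => ?_) hc3
    rw [norm_div, Real.norm_eq_abs, Real.norm_of_nonneg (sq_nonneg u)]
    gcongr
    exact Real.abs_cos_le_one u
  have hb : 1 ≤ b := ha.trans hab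
  have key : ∀ u : ℝ, 1 ≤ u → |-Real.cos u / u| ≤ 1 := by
    intro u hu
    rw [abs_div, abs_neg, abs_of_pos (by linarith : 0 < u)]
    exact (div_le_one (by linarith)).2 ((Real.abs_cos_le_one u).trans hu)
  have ka := key a ha
  have kb := key b hb
  have k1 : -1 / b - -1 / a ≤ 1 := by
    have : 0 ≤ 1 / b := by positivity
    have : 1 / a ≤ 1 := (div_le_one (by linarith)).2 ha
    ring_nf at *
    linarith
  rw [abs_le] at *
  constructor <;> linarith [h2.1, h2.2, ka.1, ka.2, kb.1, kb.2]

theorem abs_integral_sin_div_le_of_le_one {a b : ℝ} (ha : 0 < a) (hab : a ≤ b) (hb : b ≤ 1) :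
    |∫ u in a..b, Real.sin u / u| ≤ 1 := by
  have := intervalIntegral.norm_integral_le_of_norm_le_const (a := a) (b := b)
    (f := fun u => Real.sin u / u) (C := 1) (by
      intro u hu
      rw [uIoc_of_le hab] at hu
      have hu0 : 0 < u := ha.trans hu.1
      rw [Real.norm_eq_abs, abs_div]
      exact (div_le_one (abs_pos.2 hu0.ne')).2 Real.abs_sin_le_abs)
  rw [Real.norm_eq_abs, abs_of_nonneg (by linarith : 0 ≤ b - a)] at this
  linarith

theorem abs_integral_sin_div_le {a b : ℝ} (ha : 0 < a) (hab : a ≤ b) :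
    |∫ u in a..b, Real.sin u / u| ≤ 4 := by
  rcases le_total b 1 with hb | hb
  · linarith [abs_integral_sin_div_le_of_le_one ha hab hb]
  rcases le_total a 1 with ha1 | ha1
  · have hInt : ∀ c d : ℝ, 0 < c → c ≤ d →
        IntervalIntegrable (fun u => Real.sin u / u) volume c d := by
      intro c d hc hcd
      refine ContinuousOn.intervalIntegrable
        (Real.continuous_sin.continuousOn.div continuousOn_id fun u hu => ?_)
      rw [uIcc_of_le hcd] at hu
      exact (hc.trans_le hu.1).ne'
    rw [← intervalIntegral.integral_add_adjacent_intervals (hInt a 1 ha ha1)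
      (hInt 1 b one_pos hb)]
    refine (abs_add_le _ _).trans ?_
    linarith [abs_integral_sin_div_le_of_le_one ha ha1 le_rfl,
      abs_integral_sin_div_le_of_one_le le_rfl hb]
  · linarith [abs_integral_sin_div_le_of_one_le ha1 hab]

theorem abs_integral_sin_mul_div_le {a b : ℝ} (ha : 0 < a) (hab : a ≤ b) (c : ℝ) :
    |∫ r in a..b, Real.sin (c * r) / r| ≤ 4 := by
  have main : ∀ c : ℝ, 0 < c → |∫ r in a..b, Real.sin (c * r) / r| ≤ 4 := by
    intro c hc
    have h := intervalIntegral.smul_integral_comp_mul_left (a := a) (b := b)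
      (fun u => Real.sin u / u) c
    rw [smul_eq_mul, ← intervalIntegral.integral_const_mul] at h
    have h' : ∀ r : ℝ, c * (Real.sin (c * r) / (c * r)) = Real.sin (c * r) / r := by
      intro r
      field_simp
    simp only [h'] at h
    rw [h]
    exact abs_integral_sin_div_le (by positivity) (by gcongr)
  rcases lt_trichotomy c 0 with hc | rfl | hc
  · have := main (-c) (by linarith)
    simpa [neg_mul, Real.sin_neg, neg_div, intervalIntegral.integral_neg] using this
  · simp
  · exact main c hc

theorem continuous_fourier_of_integrable {V : Type*} [NormedAddCommGroup V]
    [InnerProductSpace ℝ V] [FiniteDimensional ℝ V] [MeasurableSpace V] [BorelSpace V]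
    {h : V → ℂ} (h1 : Integrable h) : Continuous (FourierTransform.fourier h : V → ℂ) :=
  VectorFourier.fourierIntegral_continuous Real.continuous_fourierChar
    (by exact continuous_inner) h1

theorem eLpNorm_fourier_eq {V : Type*} [NormedAddCommGroup V] [InnerProductSpace ℝ V]
    [FiniteDimensional ℝ V] [MeasurableSpace V] [BorelSpace V] {h : V → ℂ}
    (h1 : Integrable h) (h2 : MemLp h 2) :
    eLpNorm (FourierTransform.fourier h) 2 volume = eLpNorm h 2 volume := by
  have key : (FourierTransform.fourier (h2.toLp h) : Lp ℂ 2 (volume : Measure V))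
      =ᵐ[volume] FourierTransform.fourier h := by
    refine ae_eq_of_integral_contDiff_smul_eq
      ((Lp.memLp _).locallyIntegrable (by norm_num))
      (continuous_fourier_of_integrable h1).locallyIntegrable fun g hg hgc => ?_
    have hg₁ : HasCompactSupport (Complex.ofRealCLM ∘ g) := hgc.comp_left rfl
    have hg₂ : ContDiff ℝ ((⊤ : ℕ∞) : WithTop ℕ∞) (Complex.ofRealCLM ∘ g) :=
      Complex.ofRealCLM.contDiff.comp hg
    set ψ : SchwartzMap V ℂ := hg₁.toSchwartzMap hg₂ with hψ
    have hψa : ∀ x, ψ x = (g x : ℂ) := fun x => rfl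
    have e1 := DFunLike.congr_fun (Lp.fourier_toTemperedDistribution_eq (h2.toLp h)) ψ
    rw [Lp.toTemperedDistribution_apply, TemperedDistribution.fourier_apply,
      Lp.toTemperedDistribution_apply] at e1
    have e2 : ∫ x, (FourierTransform.fourier ψ) x • (h2.toLp h) x =
        ∫ x, (FourierTransform.fourier ψ) x • h x := by
      refine integral_congr_ae ?_
      filter_upwards [h2.coeFn_toLp] with x hx
      rw [hx]
    have e3 : ∫ x, (FourierTransform.fourier (ψ : V → ℂ)) x • h x =
        ∫ x, ψ x • (FourierTransform.fourier h) x := by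
      simpa using! VectorFourier.integral_fourierIntegral_smul_eq_flip (L := innerₗ V)
        Real.continuous_fourierChar continuous_inner ψ.integrable h1
    rw [e2, SchwartzMap.fourier_coe, e3] at e1
    simpa only [hψa, Complex.coe_smul, ← Complex.real_smul] using e1.symm
  rw [← eLpNorm_congr_ae key, ← Lp.enorm_def, ← eLpNorm_congr_ae h2.coeFn_toLp,
    ← Lp.enorm_def]
  simp only [enorm_eq_iff_norm_eq, Lp.norm_fourier_eq]

open scoped ENNReal in
theorem eLpNorm_convolution_le {V : Type*} [NormedAddCommGroup V] [InnerProductSpace ℝ V]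
    [FiniteDimensional ℝ V] [MeasurableSpace V] [BorelSpace V] {k φ : V → ℂ}
    (hk : Integrable k) (hφ : Integrable φ) {M : ℝ} (hM : ∀ x, ‖φ x‖ ≤ M) {B : ℝ}
    (hB : ∀ ξ, ‖FourierTransform.fourier k ξ‖ ≤ B) :
    eLpNorm (convolution k φ (ContinuousLinearMap.mul ℂ ℂ) volume) 2 volume ≤
      ENNReal.ofReal B * eLpNorm φ 2 volume := by
  have memLp2 : ∀ u : V → ℂ, Integrable u → ∀ C, (∀ x, ‖u x‖ ≤ C) → MemLp u 2 := by
    intro u hu C hC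
    refine (memLp_two_iff_integrable_sq_norm hu.1).2
      ((hu.norm.const_mul C).mono' (hu.1.norm.pow 2) (ae_of_all _ fun x => ?_))
    rw [Real.norm_of_nonneg (by positivity), sq]
    gcongr
    exact hC x
  have hc1 : Integrable (convolution k φ (ContinuousLinearMap.mul ℂ ℂ) volume) :=
    hk.integrable_convolution _ hφ
  have hc2 : MemLp (convolution k φ (ContinuousLinearMap.mul ℂ ℂ) volume) 2 := by
    refine memLp2 _ hc1 ((∫ x, ‖k x‖) * M) fun x => ?_
    rw [convolution_def, ← integral_mul_const]
    refine norm_integral_le_of_norm_le (hk.norm.mul_const _) (ae_of_all _ fun t => ?_)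
    rw [ContinuousLinearMap.mul_apply', norm_mul]
    gcongr
    exact hM _
  rw [← eLpNorm_fourier_eq hc1 hc2, ← eLpNorm_fourier_eq hφ (memLp2 φ hφ M hM)]
  refine eLpNorm_le_mul_eLpNorm_of_ae_le_mul (ae_of_all _ fun ξ => ?_) 2
  rw [Real.fourier_mul_convolution_eq hk hφ, norm_mul]
  gcongr
  exact hB ξ

open scoped ENNReal in
theorem lintegral_eq_lintegral_sphere {E : Type*} [NormedAddCommGroup E] [NormedSpace ℝ E]
    [FiniteDimensional ℝ E] [Nontrivial E] [MeasureSpace E] [BorelSpace E]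
    [(volume : Measure E).IsAddHaarMeasure] {n : ℕ} (hd : Module.finrank ℝ E = n)
    {F : E → ℝ≥0∞} (hF : Measurable F) :
    ∫⁻ x, F x = ∫⁻ θ : sphere (0 : E) 1,
      (∫⁻ r in Ioi (0 : ℝ), ENNReal.ofReal (r ^ (n - 1)) * F (r • (θ : E)))
      ∂(volume : Measure (E)).toSphere := by
  have hmp := (volume : Measure E).measurePreserving_homeomorphUnitSphereProd
  rw [hd] at hmp
  have hG : Measurable fun p : sphere (0 : E) 1 × Ioi (0 : ℝ) => F (p.2.1 • p.1.1) :=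
    hF.comp ((measurable_subtype_coe.comp measurable_snd).smul
      (measurable_subtype_coe.comp measurable_fst))
  calc ∫⁻ x, F x = ∫⁻ x : ({(0)}ᶜ : Set E), F x ∂(Measure.comap ((↑) : ({(0)}ᶜ : Set E) → E) volume) := by
        rw [lintegral_subtype_comap (measurableSet_singleton _).compl F,
          restrict_compl_singleton]
    _ = ∫⁻ p : sphere (0 : E) 1 × Ioi (0 : ℝ), F (p.2.1 • p.1.1)
          ∂((volume : Measure E).toSphere.prod (.volumeIoiPow (n - 1))) := by
        rw [← hmp.lintegral_comp hG]
        refine lintegral_congr fun x => ?_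
        congr 1
        have hx : ‖(x : E)‖ ≠ 0 := norm_ne_zero_iff.2 x.2
        simp [smul_smul, hx]
    _ = ∫⁻ θ : sphere (0 : E) 1, (∫⁻ r : Ioi (0 : ℝ), F (r.1 • θ.1) ∂(.volumeIoiPow (n - 1)))
          ∂(volume : Measure E).toSphere := lintegral_prod _ hG.aemeasurable
    _ = _ := by
        refine lintegral_congr fun θ => ?_
        have hm : Measurable fun r : ℝ => F (r • (θ : E)) := hF.comp (by fun_prop)
        rw [Measure.volumeIoiPow, lintegral_withDensity_eq_lintegral_mul _ (by fun_prop)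
          (g := fun r : Ioi (0 : ℝ) => F (r.1 • θ.1)) (hm.comp measurable_subtype_coe)]
        exact lintegral_subtype_comap measurableSet_Ioi
          fun r : ℝ => ENNReal.ofReal (r ^ (n - 1)) * F (r • (θ : E))

theorem integral_eq_integral_sphere {E : Type*} [NormedAddCommGroup E] [NormedSpace ℝ E]
    [FiniteDimensional ℝ E] [Nontrivial E] [MeasureSpace E] [BorelSpace E]
    [(volume : Measure E).IsAddHaarMeasure] {n : ℕ} (hd : Module.finrank ℝ E = n)
    {F : E → ℝ} (hF : Integrable F) :
    ∫ x, F x = ∫ θ : sphere (0 : E) 1,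
      (∫ r in Ioi (0 : ℝ), r ^ (n - 1) * F (r • (θ : E)))
      ∂(volume : Measure (E)).toSphere := by
  have hmp := (volume : Measure E).measurePreserving_homeomorphUnitSphereProd
  rw [hd] at hmp
  set G : sphere (0 : E) 1 × Ioi (0 : ℝ) → ℝ := fun p => F (p.2.1 • p.1.1) with hG
  have hcomp : ∀ x : ({(0)}ᶜ : Set E), G (homeomorphUnitSphereProd E x) = F x := by
    intro x
    have hx : ‖(x : E)‖ ≠ 0 := norm_ne_zero_iff.2 x.2
    simp [hG, smul_smul, hx]
  have hInt : Integrable G ((volume : Measure E).toSphere.prod (.volumeIoiPow (n - 1))) := by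
    rw [← hmp.integrable_comp_emb (Homeomorph.measurableEmbedding _)]
    have : G ∘ homeomorphUnitSphereProd E = fun x : ({(0)}ᶜ : Set E) => F x := funext hcomp
    rw [this]
    exact (integrableOn_iff_comap_subtypeVal (measurableSet_singleton _).compl).1
      hF.integrableOn
  calc ∫ x, F x = ∫ x : ({(0)}ᶜ : Set E), F x ∂(Measure.comap ((↑) : ({(0)}ᶜ : Set E) → E) volume) := by
        rw [integral_subtype_comap (measurableSet_singleton _).compl F,
          restrict_compl_singleton]
    _ = ∫ p, G p ∂((volume : Measure E).toSphere.prod (.volumeIoiPow (n - 1))) := by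
        rw [← hmp.integral_comp (Homeomorph.measurableEmbedding _)]
        exact integral_congr_ae (ae_of_all _ fun x => (hcomp x).symm)
    _ = ∫ θ : sphere (0 : E) 1, (∫ r : Ioi (0 : ℝ), G (θ, r) ∂(.volumeIoiPow (n - 1)))
          ∂(volume : Measure E).toSphere := integral_prod _ hInt
    _ = _ := by
        refine integral_congr_ae (ae_of_all _ fun θ => ?_)
        simp only [Measure.volumeIoiPow, ENNReal.ofReal]
        rw [integral_withDensity_eq_integral_smul
          ((measurable_subtype_coe.pow_const _).real_toNNReal),
          integral_subtype_comap measurableSet_Ioi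
            fun a : ℝ => Real.toNNReal (a ^ (n - 1)) • F (a • θ.1)]
        refine setIntegral_congr_fun measurableSet_Ioi fun r hr => ?_
        simp only [NNReal.smul_def, smul_eq_mul]
        rw [Real.coe_toNNReal _ (pow_nonneg (le_of_lt hr) _)]

/-- The kernel `Ω(x) / ‖x‖ ^ n` truncated to the annulus `δ ≤ ‖x‖ ≤ M`. -/
noncomputable def truncKernel {E : Type*} [NormedAddCommGroup E] (Ω : E → ℝ) (n : ℕ) (δ M : ℝ)
    (x : E) : ℝ :=
  {x : E | δ ≤ ‖x‖ ∧ ‖x‖ ≤ M}.indicator (fun x => Ω x / ‖x‖ ^ n) x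

section truncKernel

variable {E : Type*} [NormedAddCommGroup E] {Ω : E → ℝ} {n : ℕ} {δ M : ℝ}

theorem truncKernel_apply {x : E} (h1 : δ ≤ ‖x‖) (h2 : ‖x‖ ≤ M) :
    truncKernel Ω n δ M x = Ω x / ‖x‖ ^ n :=
  indicator_of_mem (show x ∈ {x : E | δ ≤ ‖x‖ ∧ ‖x‖ ≤ M} from ⟨h1, h2⟩) _

theorem truncKernel_of_norm_lt {x : E} (h : ‖x‖ < δ) : truncKernel Ω n δ M x = 0 :=
  indicator_of_notMem (fun hx => absurd hx.1 (not_le.2 h)) _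

theorem truncKernel_neg (hδ : 0 < δ) (hodd : ∀ x : E, x ≠ 0 → Ω (-x) = -Ω x) (x : E) :
    truncKernel Ω n δ M (-x) = -truncKernel Ω n δ M x := by
  unfold truncKernel
  by_cases h : x ∈ {x : E | δ ≤ ‖x‖ ∧ ‖x‖ ≤ M}
  · have hx : x ≠ 0 := norm_pos_iff.1 (hδ.trans_le h.1)
    rw [indicator_of_mem h, indicator_of_mem (by simpa using h), hodd x hx, norm_neg, neg_div]
  · rw [indicator_of_notMem h, indicator_of_notMem (by simpa using h), neg_zero]

theorem measurable_truncKernel [MeasurableSpace E] [BorelSpace E] (hΩ : Measurable Ω) :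
    Measurable (truncKernel Ω n δ M) :=
  (hΩ.div (measurable_norm.pow_const n)).indicator
    ((measurableSet_le measurable_const measurable_norm).inter
      (measurableSet_le measurable_norm measurable_const))

variable [NormedSpace ℝ E]

theorem pow_mul_truncKernel_smul (hn : 1 ≤ n)
    (hhom : ∀ x : E, x ≠ 0 → ∀ t : ℝ, 0 < t → Ω (t • x) = Ω x)
    (θ : sphere (0 : E) 1) {r : ℝ} (hr : 0 < r) :
    r ^ (n - 1) * truncKernel Ω n δ M (r • (θ : E)) =
      (Icc δ M).indicator (fun r => Ω θ * r⁻¹) r := by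
  have hθ : ‖(θ : E)‖ = 1 := by simp
  have hθ0 : (θ : E) ≠ 0 := norm_ne_zero_iff.1 (by simp)
  have hnorm : ‖r • (θ : E)‖ = r := by rw [norm_smul, hθ, mul_one, Real.norm_of_nonneg hr.le]
  by_cases h : r ∈ Icc δ M
  · rw [indicator_of_mem h, truncKernel_apply (by rw [hnorm]; exact h.1) (by rw [hnorm]; exact h.2), hnorm,
      hhom _ hθ0 r hr]
    obtain ⟨m, rfl⟩ : ∃ m, n = m + 1 := ⟨n - 1, by omega⟩
    rw [Nat.add_sub_cancel, pow_succ]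
    field_simp
  · rw [indicator_of_notMem h, truncKernel, indicator_of_notMem, mul_zero]
    rintro ⟨h1, h2⟩
    rw [hnorm] at h1 h2
    exact h ⟨h1, h2⟩

variable [FiniteDimensional ℝ E] [Nontrivial E] [MeasureSpace E] [BorelSpace E]
  [(volume : Measure E).IsAddHaarMeasure]

theorem integrable_truncKernel (hd : Module.finrank ℝ E = n) (hδ : 0 < δ) (hΩ : Measurable Ω)
    (hhom : ∀ x : E, x ≠ 0 → ∀ t : ℝ, 0 < t → Ω (t • x) = Ω x)
    (hInt : Integrable (fun θ : sphere (0 : E) 1 => Ω θ) (volume : Measure E).toSphere) :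
    Integrable (truncKernel Ω n δ M) := by
  have hn : 1 ≤ n := hd ▸ Module.finrank_pos
  have hmeas : Measurable (truncKernel Ω n δ M) := measurable_truncKernel hΩ
  refine ⟨hmeas.aestronglyMeasurable, ?_⟩
  rw [hasFiniteIntegral_iff_enorm, lintegral_eq_lintegral_sphere hd hmeas.enorm]
  have hle : ∀ θ : sphere (0 : E) 1,
      (∫⁻ r in Ioi (0 : ℝ), ENNReal.ofReal (r ^ (n - 1)) * ‖truncKernel Ω n δ M (r • (θ : E))‖ₑ) ≤
        ‖Ω θ‖ₑ * (ENNReal.ofReal δ⁻¹ * volume (Icc δ M)) := by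
    intro θ
    rw [← mul_assoc, ← setLIntegral_const, ← lintegral_indicator measurableSet_Icc]
    refine (setLIntegral_mono' measurableSet_Ioi fun r (hr : 0 < r) => ?_).trans
      (setLIntegral_le_lintegral _ _)
    rw [← Real.enorm_of_nonneg (pow_nonneg hr.le (n - 1)), ← enorm_mul,
      pow_mul_truncKernel_smul hn hhom θ hr, enorm_indicator_eq_indicator_enorm]
    refine indicator_le_indicator' fun hr' => ?_
    rw [enorm_mul, Real.enorm_of_nonneg (inv_nonneg.2 hr.le)]
    gcongr
    exact hr'.1
  refine (lintegral_mono hle).trans_lt ?_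
  rw [lintegral_mul_const' _ _ (ENNReal.mul_ne_top ENNReal.ofReal_ne_top (by simp))]
  exact ENNReal.mul_lt_top hInt.2 (ENNReal.mul_lt_top ENNReal.ofReal_lt_top (by simp))

end truncKernel

section fourier

variable {E : Type*} [NormedAddCommGroup E] [InnerProductSpace ℝ E] [FiniteDimensional ℝ E]
  [Nontrivial E] [MeasurableSpace E] [BorelSpace E]
  {Ω : E → ℝ} {n : ℕ} {δ M : ℝ}

theorem abs_integral_truncKernel_mul_sin_le (hd : Module.finrank ℝ E = n) (hδ : 0 < δ)
    (hδM : δ ≤ M) (hΩ : Measurable Ω)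
    (hhom : ∀ x : E, x ≠ 0 → ∀ t : ℝ, 0 < t → Ω (t • x) = Ω x)
    (hInt : Integrable (fun θ : sphere (0 : E) 1 => Ω θ) (volume : Measure E).toSphere) (w : E) :
    |∫ x, truncKernel Ω n δ M x * Real.sin (inner ℝ x w)| ≤
      4 * ∫ θ : sphere (0 : E) 1, |Ω θ| ∂(volume : Measure E).toSphere := by
  have hn : 1 ≤ n := hd ▸ Module.finrank_pos
  have hF : Integrable fun x : E => truncKernel Ω n δ M x * Real.sin (inner ℝ x w) :=
    (integrable_truncKernel hd hδ hΩ hhom hInt).mul_bdd (c := 1)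
      (by fun_prop) (ae_of_all _ fun x => Real.abs_sin_le_one _)
  rw [integral_eq_integral_sphere hd hF, ← integral_const_mul, ← Real.norm_eq_abs]
  refine norm_integral_le_of_norm_le (hInt.abs.const_mul 4) (ae_of_all _ fun θ => ?_)
  have : (∫ r in Ioi (0 : ℝ), r ^ (n - 1) * (truncKernel Ω n δ M (r • (θ : E)) *
      Real.sin (inner ℝ (r • (θ : E)) w))) =
      Ω θ * ∫ r in δ..M, Real.sin (inner ℝ (θ : E) w * r) / r := by
    rw [← intervalIntegral.integral_const_mul, intervalIntegral.integral_of_le hδM,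
      ← integral_Icc_eq_integral_Ioc, ← integral_indicator measurableSet_Icc,
      ← integral_indicator measurableSet_Ioi]
    congr 1
    ext r
    by_cases hr : 0 < r
    · rw [indicator_of_mem (show r ∈ Ioi 0 from hr), ← mul_assoc,
        pow_mul_truncKernel_smul hn hhom θ hr, real_inner_smul_left]
      by_cases hr' : r ∈ Icc δ M
      · rw [indicator_of_mem hr', indicator_of_mem hr', mul_comm r, div_eq_mul_inv]
        ring
      · rw [indicator_of_notMem hr', indicator_of_notMem hr', zero_mul]
    · rw [indicator_of_notMem (show r ∉ Ioi 0 from hr), indicator_of_notMem]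
      exact fun h => hr (hδ.trans_le h.1)
  rw [this, norm_mul, Real.norm_eq_abs, Real.norm_eq_abs, mul_comm]
  gcongr
  exact abs_integral_sin_mul_div_le hδ hδM _

theorem norm_fourier_truncKernel_le (hd : Module.finrank ℝ E = n) (hδ : 0 < δ)
    (hδM : δ ≤ M) (hΩ : Measurable Ω) (hodd : ∀ x : E, x ≠ 0 → Ω (-x) = -Ω x)
    (hhom : ∀ x : E, x ≠ 0 → ∀ t : ℝ, 0 < t → Ω (t • x) = Ω x)
    (hInt : Integrable (fun θ : sphere (0 : E) 1 => Ω θ) (volume : Measure E).toSphere) (ξ : E) :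
    ‖FourierTransform.fourier (fun x : E => (truncKernel Ω n δ M x : ℂ)) ξ‖ ≤
      4 * ∫ θ : sphere (0 : E) 1, |Ω θ| ∂(volume : Measure E).toSphere := by
  set k := truncKernel Ω n δ M with hk
  have hki : Integrable k := integrable_truncKernel hd hδ hΩ hhom hInt
  set w : E := (-2 * Real.pi) • ξ with hw
  have hs : Integrable fun x : E => k x * Real.sin (inner ℝ x w) :=
    hki.mul_bdd (c := 1) (by fun_prop) (ae_of_all _ fun x => Real.abs_sin_le_one _)
  have hc : Integrable fun x : E => k x * Real.cos (inner ℝ x w) :=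
    hki.mul_bdd (c := 1) (by fun_prop) (ae_of_all _ fun x => Real.abs_cos_le_one _)
  have hc0 : ∫ x : E, k x * Real.cos (inner ℝ x w) = 0 := by
    have h := integral_neg_eq_self (fun x : E => k x * Real.cos (inner ℝ x w)) volume
    simp only [hk, truncKernel_neg hδ hodd, inner_neg_left, Real.cos_neg, neg_mul,
      integral_neg] at h
    linarith
  have hF : FourierTransform.fourier (fun x : E => (k x : ℂ)) ξ =
      ((∫ x : E, k x * Real.sin (inner ℝ x w) : ℝ) : ℂ) * Complex.I := by
    have hpt : ∀ x : E, Complex.exp (((-2 * Real.pi * inner ℝ x ξ : ℝ) : ℂ) * Complex.I) •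
        (k x : ℂ) = ((k x * Real.cos (inner ℝ x w) : ℝ) : ℂ) +
          ((k x * Real.sin (inner ℝ x w) : ℝ) : ℂ) * Complex.I := by
      intro x
      rw [hw, real_inner_smul_right, Complex.exp_mul_I, ← Complex.ofReal_cos,
        ← Complex.ofReal_sin, smul_eq_mul]
      push_cast
      ring
    rw [Real.fourier_eq']
    simp only [hpt]
    rw [integral_add hc.ofReal (hs.ofReal.mul_const _), integral_mul_const,
      integral_complex_ofReal, integral_complex_ofReal, hc0]
    simp
  rw [hF, norm_mul, Complex.norm_I, mul_one, Complex.norm_real, Real.norm_eq_abs]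
  exact abs_integral_truncKernel_mul_sin_le hd hδ hδM hΩ hhom hInt w

end fourier

theorem volume_lt_abs_integral_mul_le {E : Type*} [NormedAddCommGroup E] [InnerProductSpace ℝ E]
    [FiniteDimensional ℝ E] [MeasurableSpace E] [BorelSpace E] {k φ : E → ℝ}
    (hk : Integrable k) {B : ℝ} (hB0 : 0 ≤ B)
    (hB : ∀ ξ, ‖FourierTransform.fourier (fun x : E => (k x : ℂ)) ξ‖ ≤ B)
    (hφ : Integrable φ) {t : ℝ} (ht : ∀ x, |φ x| ≤ t) {c : ℝ} (hc : 0 < c) :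
    volume {x | c < |∫ y, k (x - y) * φ y|} ≤
      ENNReal.ofReal (B ^ 2 * t / c ^ 2 * ∫ x, |φ x|) := by
  have ht0 : 0 ≤ t := (abs_nonneg _).trans (ht 0)
  set u : E → ℂ := convolution (fun x : E => (k x : ℂ)) (fun x : E => (φ x : ℂ))
    (ContinuousLinearMap.mul ℂ ℂ) volume with hu
  have hux : ∀ x, ‖u x‖ = |∫ y, k (x - y) * φ y| := by
    intro x
    have h1 : u x = ((∫ y, k (x - y) * φ y : ℝ) : ℂ) := by
      rw [hu, convolution_def, ← integral_complex_ofReal,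
        ← integral_sub_left_eq_self _ volume x]
      simp
    rw [h1, Complex.norm_real, Real.norm_eq_abs]
  have hL2 : eLpNorm u 2 volume ≤
      ENNReal.ofReal B * eLpNorm (fun x : E => (φ x : ℂ)) 2 volume :=
    eLpNorm_convolution_le hk.ofReal hφ.ofReal (M := t) (fun x => by simpa using ht x) hB
  have hsq : eLpNorm (fun x : E => (φ x : ℂ)) 2 volume ^ (2 : ℝ) ≤
      ENNReal.ofReal (t * ∫ x, |φ x|) := by
    rw [← integral_const_mul, ofReal_integral_eq_lintegral_ofReal (hφ.abs.const_mul t)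
      (ae_of_all _ fun x => by positivity)]
    have := eLpNorm_nnreal_pow_eq_lintegral (f := fun x : E => (φ x : ℂ)) (p := 2)
      (μ := volume) (by norm_num)
    norm_num at this
    norm_num
    rw [this]
    refine lintegral_mono fun x => ?_
    rw [← ofReal_norm, ← ENNReal.ofReal_pow (norm_nonneg _)]
    refine ENNReal.ofReal_le_ofReal ?_
    rw [Complex.norm_real, Real.norm_eq_abs, sq]
    gcongr
    exact ht x
  have hcheb := meas_ge_le_mul_pow_eLpNorm_enorm (p := 2) (volume : Measure E) (by norm_num)
    (by norm_num) (f := u) (hk.ofReal.integrable_convolution _ hφ.ofReal).1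
    (ε := ENNReal.ofReal c) (by simpa using hc) (fun h => absurd h ENNReal.ofReal_ne_top)
  calc volume {x | c < |∫ y, k (x - y) * φ y|}
      ≤ volume {x | ENNReal.ofReal c ≤ ‖u x‖ₑ} := by
        refine measure_mono fun x (hx : c < _) => ?_
        change ENNReal.ofReal c ≤ ‖u x‖ₑ
        rw [← ofReal_norm, hux]
        exact ENNReal.ofReal_le_ofReal hx.le
    _ ≤ (ENNReal.ofReal c)⁻¹ ^ (2 : ℝ) * eLpNorm u 2 volume ^ (2 : ℝ) := by simpa using hcheb
    _ ≤ (ENNReal.ofReal c)⁻¹ ^ (2 : ℝ) *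
          (ENNReal.ofReal B * eLpNorm (fun x : E => (φ x : ℂ)) 2 volume) ^ (2 : ℝ) := by
        gcongr
    _ ≤ (ENNReal.ofReal c)⁻¹ ^ (2 : ℝ) *
          (ENNReal.ofReal B ^ (2 : ℝ) * ENNReal.ofReal (t * ∫ x, |φ x|)) := by
        rw [ENNReal.mul_rpow_of_nonneg _ _ (by norm_num)]
        gcongr
    _ = _ := by
        rw [← ENNReal.ofReal_inv_of_pos hc, ENNReal.ofReal_rpow_of_nonneg (by positivity)
          (by norm_num), ENNReal.ofReal_rpow_of_nonneg hB0 (by norm_num),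
          ← ENNReal.ofReal_mul (by positivity), ← ENNReal.ofReal_mul (by positivity)]
        congr 1
        norm_num
        field_simp

open Topology in
theorem tendsto_lintegral_enorm_translate_sub {E : Type*} [NormedAddCommGroup E]
    [NormedSpace ℝ E] [FiniteDimensional ℝ E] [MeasureSpace E] [BorelSpace E]
    [(volume : Measure E).IsAddHaarMeasure] {k : E → ℝ} (hk : Integrable k) (y : E) :
    Tendsto (fun z => ∫⁻ x, ‖k (x - y) - k (x - z)‖ₑ) (𝓝 y) (𝓝 0) := by
  set g : C(E, C(E, E)) := (ContinuousMap.mk fun p : E × E => p.2 - p.1).curry with hg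
  have hgm : ∀ z, MeasurePreserving (g z) (volume : Measure E) volume := fun z =>
    measurePreserving_sub_right volume z
  have hcont : Continuous fun z => Lp.compMeasurePreserving (g z) (hgm z) hk.toL1 :=
    continuous_const.compMeasurePreservingLp g.continuous hgm (by norm_num)
  have h := (continuous_const.edist hcont).tendsto (x := y)
    (f := fun z => edist (Lp.compMeasurePreserving (g y) (hgm y) hk.toL1)
      (Lp.compMeasurePreserving (g z) (hgm z) hk.toL1))
  rw [edist_self] at h
  refine h.congr fun z => ?_
  have hz : ∀ z, Lp.compMeasurePreserving (g z) (hgm z) hk.toL1 =ᵐ[volume]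
      fun x => k (x - z) := fun z =>
    (Lp.coeFn_compMeasurePreserving _ _).trans
      ((hgm z).quasiMeasurePreserving.ae_eq_comp hk.coeFn_toL1)
  rw [Lp.edist_def, eLpNorm_one_eq_lintegral_enorm]
  refine lintegral_congr_ae ?_
  filter_upwards [hz y, hz z] with x h1 h2
  simp only [Pi.sub_apply, h1, h2]

open Topology in
theorem tendsto_lintegral_integral_sub_comp {E : Type*} [NormedAddCommGroup E]
    [NormedSpace ℝ E] [FiniteDimensional ℝ E] [MeasureSpace E] [BorelSpace E]
    [(volume : Measure E).IsAddHaarMeasure] {k F : E → ℝ} (hkm : Measurable k)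
    (hk : Integrable k) (hFm : Measurable F) (hF : Integrable F) {s : ℕ → SimpleFunc E E}
    (hs : ∀ y, F y ≠ 0 → Tendsto (fun j => s j y) atTop (𝓝 y)) :
    Tendsto (fun j => ∫⁻ x, ‖(∫ y, k (x - y) * F y) - ∫ y, k (x - s j y) * F y‖ₑ)
      atTop (𝓝 0) := by
  have hbound : ∀ j, ∫⁻ x, ‖(∫ y, k (x - y) * F y) - ∫ y, k (x - s j y) * F y‖ₑ ≤
      ∫⁻ y, (∫⁻ x, ‖k (x - y) - k (x - s j y)‖ₑ) * ‖F y‖ₑ := by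
    intro j
    have hInt1 : ∀ᵐ x, Integrable fun y => k (x - y) * F y := by
      have := hF.ae_convolution_exists (ContinuousLinearMap.mul ℝ ℝ) hk
      filter_upwards [this] with x hx
      refine Integrable.congr hx (ae_of_all _ fun y => ?_)
      simp [mul_comm]
    have hInt2 : ∀ x, Integrable fun y => k (x - s j y) * F y := by
      intro x
      obtain ⟨C, hC⟩ := ((s j).map fun z => k (x - z)).exists_forall_norm_le
      exact hF.bdd_mul ((s j).map fun z => k (x - z)).measurable.aestronglyMeasurable
        (ae_of_all _ hC)
    have hm : Measurable fun p : E × E => ‖k (p.1 - p.2) - k (p.1 - s j p.2)‖ₑ * ‖F p.2‖ₑ := by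
      refine Measurable.mul (Measurable.enorm (Measurable.sub ?_ ?_)) ?_
      · exact hkm.comp (measurable_fst.sub measurable_snd)
      · exact hkm.comp (measurable_fst.sub ((s j).measurable.comp measurable_snd))
      · exact (hFm.comp measurable_snd).enorm
    calc _ ≤ ∫⁻ x, ∫⁻ y, ‖k (x - y) - k (x - s j y)‖ₑ * ‖F y‖ₑ := by
          refine lintegral_mono_ae ?_
          filter_upwards [hInt1] with x hx
          rw [← integral_sub hx (hInt2 x)]
          refine (enorm_integral_le_lintegral_enorm _).trans_eq (lintegral_congr fun y => ?_)
          rw [← sub_mul, enorm_mul]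
      _ = ∫⁻ y, ∫⁻ x, ‖k (x - y) - k (x - s j y)‖ₑ * ‖F y‖ₑ :=
          lintegral_lintegral_swap hm.aemeasurable
      _ = _ := lintegral_congr fun y => lintegral_mul_const' _ _ enorm_ne_top
  have htrans : ∀ z, ∫⁻ x, ‖k (x - z)‖ₑ = ∫⁻ x, ‖k x‖ₑ := fun z =>
    lintegral_sub_right_eq_self (fun x => ‖k x‖ₑ) z
  refine tendsto_of_tendsto_of_tendsto_of_le_of_le tendsto_const_nhds ?_
    (fun _ => zero_le) hbound
  have hlim := tendsto_lintegral_of_dominated_convergence (μ := volume)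
    (F := fun j y => (∫⁻ x, ‖k (x - y) - k (x - s j y)‖ₑ) * ‖F y‖ₑ) (f := fun _ => 0)
    (fun y => (2 * ∫⁻ x, ‖k x‖ₑ) * ‖F y‖ₑ) ?_ ?_ ?_ ?_
  · simpa using hlim
  · intro j
    refine Measurable.mul (Measurable.lintegral_prod_left' (f := fun p : E × E =>
      ‖k (p.1 - p.2) - k (p.1 - s j p.2)‖ₑ) (Measurable.enorm (Measurable.sub ?_ ?_))) hFm.enorm
    · exact hkm.comp (measurable_fst.sub measurable_snd)
    · exact hkm.comp (measurable_fst.sub ((s j).measurable.comp measurable_snd))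
  · refine fun j => ae_of_all _ fun y => mul_le_mul ?_ le_rfl zero_le zero_le
    calc _ ≤ ∫⁻ x, (‖k (x - y)‖ₑ + ‖k (x - s j y)‖ₑ) :=
          lintegral_mono fun x => enorm_sub_le
      _ = 2 * ∫⁻ x, ‖k x‖ₑ := by
          rw [lintegral_add_left (f := fun x => ‖k (x - y)‖ₑ)
            (hkm.comp (measurable_id.sub_const y)).enorm, htrans, htrans,
            two_mul]
  · rw [lintegral_const_mul _ hFm.enorm]
    exact ENNReal.mul_ne_top (ENNReal.mul_ne_top (by norm_num) hk.2.ne) hF.2.ne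
  · refine ae_of_all _ fun y => ?_
    by_cases hy : F y = 0
    · simp [hy]
    · have := (tendsto_lintegral_enorm_translate_sub hk y).comp (hs y hy)
      simpa using ENNReal.Tendsto.mul_const this (Or.inr enorm_ne_top)

/-- The supremum of the distribution functions at height `lam` of `Tν`, over finite positive
combinations `ν` of Dirac masses of total mass at most `m`, for the convolution kernel `K`. -/
noncomputable def diracDistribSup {E : Type*} [AddGroup E] [MeasureSpace E] (K : E → ℝ)
    (lam m : ℝ) : ENNReal :=
  ⨆ (N : ℕ) (c : Fin N → E) (a : Fin N → ℝ) (_ : ∀ k, 0 < a k) (_ : ∑ k, a k ≤ m),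
    volume {x : E | lam < |∑ k, a k * K (x - c k)|}

theorem volume_lt_abs_sum_le_diracDistribSup {E : Type*} [AddGroup E] [MeasureSpace E]
    (K : E → ℝ) (lam : ℝ) {m : ℝ} (s : Finset E) {b : E → ℝ} (hb : ∀ v, 0 ≤ b v)
    (hm : ∑ v ∈ s, b v ≤ m) :
    volume {x : E | lam < |∑ v ∈ s, b v * K (x - v)|} ≤ diracDistribSup K lam m := by
  classical
  set u := s.filter fun v => 0 < b v with hu
  have hsum : ∀ w : E → ℝ, ∑ v ∈ s, b v * w v =
      ∑ i : Fin u.card, b (u.equivFin.symm i) * w (u.equivFin.symm i) := by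
    intro w
    rw [Equiv.sum_comp u.equivFin.symm (fun v : u => b v * w v),
      Finset.sum_coe_sort u (fun v => b v * w v), hu]
    refine (Finset.sum_filter_of_ne fun v _ hv => ?_).symm
    exact (hb v).lt_of_ne fun h => hv (by rw [← h, zero_mul])
  refine le_iSup_of_le u.card <| le_iSup_of_le (fun i => (u.equivFin.symm i : E)) <|
    le_iSup_of_le (fun i => b (u.equivFin.symm i)) <| le_iSup_of_le (fun i => ?_) <|
    le_iSup_of_le ?_ ?_
  · exact (Finset.mem_filter.1 (u.equivFin.symm i).2).2
  · simpa using (hsum fun _ => 1).symm.trans_le (by simpa using hm)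
  · exact le_of_eq (by simp only [hsum])

theorem SimpleFunc.integral_comp_mul {E : Type*} [MeasureSpace E] (s : SimpleFunc E E)
    (w : E → ℝ) {F : E → ℝ} (hF : Integrable F) :
    ∫ y, w (s y) * F y = ∑ v ∈ s.range, (∫ y in s ⁻¹' {v}, F y) * w v := by
  classical
  have h : ∀ y, w (s y) * F y = ∑ v ∈ s.range, (s ⁻¹' {v}).indicator F y * w v := by
    intro y
    rw [Finset.sum_eq_single (s y)]
    · rw [indicator_of_mem (by simp), mul_comm]
    · intro v _ hv
      rw [indicator_of_notMem (fun h => hv (by simpa using h.symm)), zero_mul]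
    · exact fun h => absurd (s.mem_range_self y) h
  simp_rw [h]
  rw [integral_finsetSum _ fun v _ => (hF.indicator (s.measurableSet_fiber v)).mul_const _]
  simp_rw [integral_mul_const, integral_indicator (s.measurableSet_fiber _)]

theorem volume_lt_abs_integral_simpleFunc_le {E : Type*} [AddGroup E] [MeasureSpace E]
    (K : E → ℝ) {lam : ℝ} (s : SimpleFunc E E) {F : E → ℝ}
    (hF : Integrable F) (hF0 : ∀ y, 0 ≤ F y) {m : ℝ} (hm : 16 * ∫ y, F y ≤ m) :
    volume {x : E | lam / 16 < |∫ y, K (x - s y) * F y|} ≤ diracDistribSup K lam m := by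
  have hmass : ∑ v ∈ s.range, ∫ y in s ⁻¹' {v}, F y = ∫ y, F y := by
    simpa using (SimpleFunc.integral_comp_mul s (fun _ => 1) hF).symm
  refine le_trans (measure_mono fun x hx => ?_)
    (volume_lt_abs_sum_le_diracDistribSup K lam s.range
      (b := fun v => 16 * ∫ y in s ⁻¹' {v}, F y)
      (fun v => mul_nonneg (by norm_num) (integral_nonneg hF0)) (m := m)
      (by rwa [← Finset.mul_sum, hmass]))
  have hx' : lam / 16 < |∫ y, K (x - s y) * F y| := hx
  rw [SimpleFunc.integral_comp_mul s (fun v => K (x - v)) hF] at hx'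
  change lam < |_|
  simp_rw [mul_assoc, ← Finset.mul_sum, abs_mul]
  norm_num
  linarith

open Topology in
theorem volume_lt_abs_integral_le_diracDistribSup {E : Type*} [NormedAddCommGroup E]
    [NormedSpace ℝ E] [FiniteDimensional ℝ E] [MeasureSpace E] [BorelSpace E]
    [(volume : Measure E).IsAddHaarMeasure] {K k F : E → ℝ} (hkm : Measurable k)
    (hk : Integrable k) (hFm : Measurable F) (hF : Integrable F) (hF0 : ∀ y, 0 ≤ F y)
    {lam : ℝ} (hlam : 0 < lam) {m : ℝ} (hm : 16 * ∫ y, F y ≤ m) {S G : Set E}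
    (hS : ∀ y, F y ≠ 0 → y ∈ S) (hG : ∀ x ∈ G, ∀ c ∈ S, k (x - c) = K (x - c)) :
    volume {x | x ∈ G ∧ lam / 8 < |∫ y, k (x - y) * F y|} ≤ diracDistribSup K lam m := by
  rcases S.eq_empty_or_nonempty with rfl | ⟨y₀, hy₀⟩
  · have hF' : ∀ y, F y = 0 := fun y => by_contra (hS y)
    have h8 : ¬ lam / 8 < 0 := by linarith
    simp [hF', h8]
  set s : ℕ → SimpleFunc E E := SimpleFunc.approxOn id measurable_id S y₀ hy₀ with hs
  have hsS : ∀ j y, s j y ∈ S := fun j y => SimpleFunc.approxOn_mem measurable_id hy₀ j y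
  have hlim := tendsto_lintegral_integral_sub_comp hkm hk hFm hF (s := s) fun y hy =>
    SimpleFunc.tendsto_approxOn measurable_id hy₀ (subset_closure (hS y hy))
  have hc : ENNReal.ofReal (lam / 16) ≠ 0 := by
    simpa using hlam
  have hmeas : ∀ j, AEMeasurable
      fun x => ‖(∫ y, k (x - y) * F y) - ∫ y, k (x - s j y) * F y‖ₑ := by
    intro j
    refine (AEStronglyMeasurable.sub ?_ ?_).enorm
    · refine StronglyMeasurable.aestronglyMeasurable (StronglyMeasurable.integral_prod_right'
        (f := fun p : E × E => k (p.1 - p.2) * F p.2) (Measurable.stronglyMeasurable ?_))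
      exact (hkm.comp (measurable_fst.sub measurable_snd)).mul (hFm.comp measurable_snd)
    · refine StronglyMeasurable.aestronglyMeasurable (StronglyMeasurable.integral_prod_right'
        (f := fun p : E × E => k (p.1 - s j p.2) * F p.2) (Measurable.stronglyMeasurable ?_))
      exact (hkm.comp (measurable_fst.sub ((s j).measurable.comp measurable_snd))).mul
        (hFm.comp measurable_snd)
  have hj : ∀ j, volume {x | x ∈ G ∧ lam / 8 < |∫ y, k (x - y) * F y|} ≤
      diracDistribSup K lam m +
        (∫⁻ x, ‖(∫ y, k (x - y) * F y) - ∫ y, k (x - s j y) * F y‖ₑ) /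
          ENNReal.ofReal (lam / 16) := by
    intro j
    refine le_trans (measure_mono ?_) ((measure_union_le _ _).trans (add_le_add
      (volume_lt_abs_integral_simpleFunc_le K (s j) hF hF0 hm)
      (meas_ge_le_lintegral_div (hmeas j) hc ENNReal.ofReal_ne_top)))
    rintro x ⟨hxG, hx⟩
    have hKk : ∫ y, K (x - s j y) * F y = ∫ y, k (x - s j y) * F y := by
      simp_rw [hG x hxG _ (hsS j _)]
    by_cases h : lam / 16 < |∫ y, K (x - s j y) * F y|
    · exact Or.inl h
    · right
      rw [not_lt, hKk] at h
      change ENNReal.ofReal (lam / 16) ≤ ‖_‖ₑ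
      rw [← ofReal_norm]
      refine ENNReal.ofReal_le_ofReal ?_
      rw [Real.norm_eq_abs]
      have := abs_sub_abs_le_abs_sub (∫ y, k (x - y) * F y) (∫ y, k (x - s j y) * F y)
      linarith
  refine ge_of_tendsto' (x := atTop) ?_ hj
  simpa using tendsto_const_nhds.add
    (ENNReal.Tendsto.div_const hlim (Or.inr hc))

theorem volume_lt_abs_integral_mul_le_add_diracDistribSup {E : Type*} [NormedAddCommGroup E]
    [InnerProductSpace ℝ E] [FiniteDimensional ℝ E] [MeasurableSpace E] [BorelSpace E]
    {K k f : E → ℝ} (hkm : Measurable k) (hk : Integrable k) {B : ℝ} (hB0 : 0 ≤ B)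
    (hB : ∀ ξ, ‖FourierTransform.fourier (fun x : E => (k x : ℂ)) ξ‖ ≤ B)
    (hfm : Measurable f) (hf : Integrable f) {C : ℝ} (hC : ∀ y, |f y| ≤ C)
    {t : ℝ} (ht : 0 < t) {lam : ℝ} (hlam : 0 < lam) {G : Set E}
    (hG : ∀ x ∈ G, ∀ c, t ≤ |f c| → k (x - c) = K (x - c)) :
    volume {x | x ∈ G ∧ lam < |∫ y, k (x - y) * f y|} ≤
      ENNReal.ofReal (B ^ 2 * t / (lam / 2) ^ 2 * ∫ x, |f x|) +
        2 * diracDistribSup K lam (16 * ∫ x, |f x|) := by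
  set f₁ := {y | |f y| < t}.indicator f with hf₁
  set f₂ := {y | t ≤ f y}.indicator f with hf₂
  set f₃ := {y | f y ≤ -t}.indicator (-f) with hf₃
  have hs₁ : MeasurableSet {y | |f y| < t} := measurableSet_lt hfm.abs measurable_const
  have hs₂ : MeasurableSet {y | t ≤ f y} := measurableSet_le measurable_const hfm
  have hs₃ : MeasurableSet {y | f y ≤ -t} := measurableSet_le hfm measurable_const
  have hi₁ : Integrable f₁ := hf.indicator hs₁
  have hi₂ : Integrable f₂ := hf.indicator hs₂
  have hi₃ : Integrable f₃ := hf.neg.indicator hs₃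
  have hbd : ∀ (s : Set E) (φ : E → ℝ), (∀ y, |φ y| = |f y|) →
      ∀ y, |s.indicator φ y| ≤ |f y| := by
    intro s φ hφ y
    by_cases h : y ∈ s
    · rw [indicator_of_mem h, hφ]
    · rw [indicator_of_notMem h, abs_zero]
      exact abs_nonneg _
  have hb₁ : ∀ y, |f₁ y| ≤ |f y| := hbd _ _ fun _ => rfl
  have hb₂ : ∀ y, |f₂ y| ≤ |f y| := hbd _ _ fun _ => rfl
  have hb₃ : ∀ y, |f₃ y| ≤ |f y| := hbd _ _ fun y => abs_neg (f y)
  have hnn₂ : ∀ y, 0 ≤ f₂ y := indicator_nonneg fun y (hy : t ≤ f y) => ht.le.trans hy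
  have hnn₃ : ∀ y, 0 ≤ f₃ y := indicator_nonneg fun y (hy : f y ≤ -t) => by
    change 0 ≤ -f y
    linarith
  have hsplit : ∀ y, f y = f₁ y + f₂ y - f₃ y := by
    intro y
    simp only [hf₁, hf₂, hf₃, indicator_apply, mem_ofPred_eq, abs_lt, Pi.neg_apply]
    split_ifs <;> first | (exfalso; linarith) | skip
    all_goals grind
  have hmul : ∀ x (φ : E → ℝ), Integrable φ → (∀ y, |φ y| ≤ |f y|) →
      Integrable fun y => k (x - y) * φ y := by
    intro x φ hφ hφb
    exact (hk.comp_sub_left x).mul_bdd (c := C) hφ.1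
      (ae_of_all _ fun y => (hφb y).trans (hC y))
  have hmass : ∀ φ : E → ℝ, Integrable φ → (∀ y, |φ y| ≤ |f y|) →
      16 * ∫ y, φ y ≤ 16 * ∫ y, |f y| := by
    intro φ hφ hφb
    exact mul_le_mul_of_nonneg_left (integral_mono hφ hf.abs fun y =>
      (le_abs_self _).trans (hφb y)) (by norm_num)
  have hgood := volume_lt_abs_integral_mul_le hk hB0 hB hi₁ (t := t) (fun y => by
    by_cases h : y ∈ {y | |f y| < t}
    · rw [hf₁, indicator_of_mem h]
      exact le_of_lt h
    · rw [hf₁, indicator_of_notMem h, abs_zero]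
      exact ht.le) (half_pos hlam)
  have hbad₂ := volume_lt_abs_integral_le_diracDistribSup (K := K) hkm hk
    (hfm.indicator hs₂) hi₂ hnn₂ hlam (hmass _ hi₂ hb₂) (S := {y | t ≤ f y}) (G := G)
    (fun y hy => mem_of_indicator_ne_zero hy)
    (fun x hx c hc => hG x hx c (le_trans hc (le_abs_self _)))
  have hbad₃ := volume_lt_abs_integral_le_diracDistribSup (K := K) hkm hk
    (hfm.neg.indicator hs₃) hi₃ hnn₃ hlam (hmass _ hi₃ hb₃) (S := {y | f y ≤ -t}) (G := G)
    (fun y hy => mem_of_indicator_ne_zero hy)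
    (fun x hx c hc => hG x hx c (le_trans (le_neg_of_le_neg hc) (neg_le_abs _)))
  have hgood' : volume {x | lam / 2 < |∫ y, k (x - y) * f₁ y|} ≤
      ENNReal.ofReal (B ^ 2 * t / (lam / 2) ^ 2 * ∫ x, |f x|) := by
    refine hgood.trans (ENNReal.ofReal_le_ofReal ?_)
    exact mul_le_mul_of_nonneg_left (integral_mono hi₁.abs hf.abs hb₁) (by positivity)
  refine le_trans (measure_mono (t := {x | lam / 2 < |∫ y, k (x - y) * f₁ y|} ∪
      ({x | x ∈ G ∧ lam / 8 < |∫ y, k (x - y) * f₂ y|} ∪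
        {x | x ∈ G ∧ lam / 8 < |∫ y, k (x - y) * f₃ y|})) ?_) ?_
  · rintro x ⟨hxG, hx⟩
    by_contra hcon
    simp only [mem_union, mem_ofPred_eq, not_or, not_and, not_lt] at hcon
    have h1 := hcon.1
    have h2 := hcon.2.1 hxG
    have h3 := hcon.2.2 hxG
    have heq : ∫ y, k (x - y) * f y = (∫ y, k (x - y) * f₁ y) + (∫ y, k (x - y) * f₂ y) -
        ∫ y, k (x - y) * f₃ y := by
      rw [← integral_add (hmul x _ hi₁ hb₁) (hmul x _ hi₂ hb₂),
        ← integral_sub (f := fun y => k (x - y) * f₁ y + k (x - y) * f₂ y)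
          ((hmul x _ hi₁ hb₁).add (hmul x _ hi₂ hb₂)) (hmul x _ hi₃ hb₃)]
      refine integral_congr_ae (ae_of_all _ fun y => ?_)
      change k (x - y) * f y = _
      rw [hsplit y]
      ring
    rw [heq] at hx
    have h4 := abs_sub ((∫ y, k (x - y) * f₁ y) + (∫ y, k (x - y) * f₂ y))
      (∫ y, k (x - y) * f₃ y)
    have h5 := abs_add_le (∫ y, k (x - y) * f₁ y) (∫ y, k (x - y) * f₂ y)
    linarith
  · refine (measure_union_le _ _).trans (add_le_add hgood' ?_)
    rw [two_mul]
    exact (measure_union_le _ _).trans (add_le_add hbad₂ hbad₃)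

open Topology in
/-- Fatou's lemma for distribution functions. -/
theorem measure_lt_abs_le_of_tendsto {α : Type*} [MeasurableSpace α] {μ : Measure α}
    {T : ℕ → α → ℝ} {g : α → ℝ} {G : ℕ → Set α} (hG : ∀ x, ∀ᶠ m in atTop, x ∈ G m)
    (hT : ∀ᵐ x ∂μ, Tendsto (fun m => T m x) atTop (𝓝 (g x))) {lam : ℝ} {C : ℕ → ENNReal}
    {c : ENNReal} (hC : Tendsto C atTop (𝓝 c))
    (hle : ∀ m, μ {x | x ∈ G m ∧ lam < |T m x|} ≤ C m) :
    μ {x | lam < |g x|} ≤ c := by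
  set A : ℕ → Set α := fun m => {x | x ∈ G m ∧ lam < |T m x|} with hA
  have hsub : {x | lam < |g x|} ≤ᵐ[μ] ⋃ j, ⋂ m, ⋂ (_ : j ≤ m), A m := by
    filter_upwards [hT] with x hx h
    have hev := (hG x).and (hx.abs.eventually (eventually_gt_nhds (show lam < |g x| from h)))
    obtain ⟨j, hj⟩ := eventually_atTop.1 hev
    change x ∈ ⋃ j, ⋂ m, ⋂ (_ : j ≤ m), A m
    simp only [mem_iUnion, mem_iInter]
    exact ⟨j, hj⟩
  refine (measure_mono_ae hsub).trans ?_
  have hmono : Monotone fun j => ⋂ m, ⋂ (_ : j ≤ m), A m := fun i j hij =>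
    iInter_mono fun m => iInter_mono' fun h => ⟨hij.trans h, le_rfl⟩
  rw [hmono.measure_iUnion]
  refine iSup_le fun j => ge_of_tendsto hC ?_
  filter_upwards [eventually_ge_atTop j] with m hm
  exact (measure_mono (iInter₂_subset m hm)).trans (hle m)

section homogeneousKernel

variable {E : Type*} [NormedAddCommGroup E] [InnerProductSpace ℝ E] [FiniteDimensional ℝ E]
  [Nontrivial E] [MeasurableSpace E] [BorelSpace E] {Ω : E → ℝ} {n : ℕ} {δ R r lam t : ℝ}

theorem volume_lt_abs_truncated_integral_le (hd : Module.finrank ℝ E = n) (hδ : 0 < δ)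
    (hδR : δ ≤ R) (hΩ : Measurable Ω) (hodd : ∀ x : E, x ≠ 0 → Ω (-x) = -Ω x)
    (hhom : ∀ x : E, x ≠ 0 → ∀ t : ℝ, 0 < t → Ω (t • x) = Ω x)
    (hInt : Integrable (fun θ : sphere (0 : E) 1 => Ω θ) (volume : Measure E).toSphere)
    {f : E → ℝ} (hf : Continuous f) (hcs : HasCompactSupport f) (hr : 0 ≤ r)
    (hfr : tsupport f ⊆ closedBall 0 r) (ht : 0 < t) (hlam : 0 < lam) :
    volume {x | x ∈ closedBall (0 : E) R ∧
        lam < |∫ y in {y : E | δ ≤ ‖x - y‖}, (Ω (x - y) / ‖x - y‖ ^ n) * f y|} ≤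
      volume (thickening δ {y | t ≤ |f y|}) +
        (ENNReal.ofReal ((4 * ∫ θ : sphere (0 : E) 1, |Ω θ| ∂(volume : Measure E).toSphere) ^ 2
            * t / (lam / 2) ^ 2 * ∫ x, |f x|) +
          2 * diracDistribSup (fun x => Ω x / ‖x‖ ^ n) lam (16 * ∫ x, |f x|)) := by
  obtain ⟨C, hC⟩ := hcs.exists_bound_of_continuous hf
  have hball : ∀ x ∈ closedBall (0 : E) R, ∀ y, f y ≠ 0 → ‖x - y‖ ≤ R + r := by
    intro x hx y hy
    have h1 := hfr (subset_tsupport f hy)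
    rw [mem_closedBall_zero_iff] at h1 hx
    exact (norm_sub_le _ _).trans (add_le_add hx h1)
  set k := truncKernel Ω n δ (R + r) with hkdef
  have hmain := volume_lt_abs_integral_mul_le_add_diracDistribSup
    (K := fun x => Ω x / ‖x‖ ^ n) (k := k) (measurable_truncKernel hΩ)
    (integrable_truncKernel hd hδ hΩ hhom hInt)
    (B := 4 * ∫ θ : sphere (0 : E) 1, |Ω θ| ∂(volume : Measure E).toSphere)
    (mul_nonneg (by norm_num) (integral_nonneg fun _ => abs_nonneg _))
    (norm_fourier_truncKernel_le hd hδ (by linarith) hΩ hodd hhom hInt)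
    hf.measurable (hf.integrable_of_hasCompactSupport hcs) hC ht hlam
    (G := closedBall 0 R \ thickening δ {y | t ≤ |f y|}) (by
      rintro x ⟨hx, hxS⟩ c hc
      have hc0 : f c ≠ 0 := fun h => by
        rw [h, abs_zero] at hc
        linarith
      refine truncKernel_apply ?_ (hball x hx c hc0)
      by_contra! h
      exact hxS (mem_thickening_iff.2 ⟨c, hc, by rwa [dist_eq_norm]⟩))
  refine le_trans (measure_mono ?_) ((measure_union_le _ _).trans (add_le_add le_rfl hmain))
  rintro x ⟨hx, hlt⟩
  by_cases hxS : x ∈ thickening δ {y | t ≤ |f y|}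
  · exact Or.inl hxS
  · refine Or.inr ⟨⟨hx, hxS⟩, ?_⟩
    have hms : MeasurableSet {y : E | δ ≤ ‖x - y‖} :=
      measurableSet_le measurable_const (measurable_const.sub measurable_id).norm
    rw [← integral_indicator hms] at hlt
    refine hlt.trans_eq (congrArg _ (integral_congr_ae (ae_of_all _ fun y => ?_)))
    by_cases hy : f y = 0
    · simp [hy, indicator_apply]
    · by_cases h : δ ≤ ‖x - y‖
      · rw [indicator_of_mem (show y ∈ {y : E | δ ≤ ‖x - y‖} from h), hkdef]
        simp only [truncKernel_apply h (hball x hx y hy)]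
      · rw [indicator_of_notMem (show y ∉ {y : E | δ ≤ ‖x - y‖} from h), hkdef]
        simp only [truncKernel_of_norm_lt (not_le.1 h), zero_mul]

open Topology in
theorem volume_lt_abs_le_add_diracDistribSup (hd : Module.finrank ℝ E = n) (hΩ : Measurable Ω)
    (hodd : ∀ x : E, x ≠ 0 → Ω (-x) = -Ω x)
    (hhom : ∀ x : E, x ≠ 0 → ∀ t : ℝ, 0 < t → Ω (t • x) = Ω x)
    (hInt : Integrable (fun θ : sphere (0 : E) 1 => Ω θ) (volume : Measure E).toSphere)
    (hlam : 0 < lam) {f : E → ℝ} (hf : Continuous f) (hcs : HasCompactSupport f) {g : E → ℝ}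
    (hg : ∀ᵐ x : E, Tendsto (fun ε : ℝ => ∫ y in {y : E | ε ≤ ‖x - y‖},
      (Ω (x - y) / ‖x - y‖ ^ n) * f y) (𝓝[>] 0) (𝓝 (g x))) :
    volume {x | lam < |g x|} ≤
      ENNReal.ofReal ((1 + 65 * ∫ θ : sphere (0 : E) 1, |Ω θ| ∂(volume : Measure E).toSphere) *
        ((1 / lam) * ∫ x, |f x|)) +
      2 * diracDistribSup (fun x => Ω x / ‖x‖ ^ n) lam (16 * ∫ x, |f x|) := by
  set W := ∫ θ : sphere (0 : E) 1, |Ω θ| ∂(volume : Measure E).toSphere with hW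
  have hW0 : 0 ≤ W := integral_nonneg fun _ => abs_nonneg _
  set I := ∫ x, |f x| with hI
  have hI0 : 0 ≤ I := integral_nonneg fun _ => abs_nonneg _
  have hfi : Integrable f := hf.integrable_of_hasCompactSupport hcs
  set t := lam / (1 + W) with ht
  have ht0 : 0 < t := by positivity
  set S := {y | t ≤ |f y|} with hS
  obtain ⟨r, hr, hfr⟩ := hcs.isCompact.isBounded.subset_closedBall_lt 0 0
  have hSclosed : IsClosed S := isClosed_le continuous_const hf.abs
  have hSbdd : Bornology.IsBounded S := hcs.isCompact.isBounded.subset fun y (hy : t ≤ |f y|) =>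
    subset_tsupport f fun h => by
      rw [h, abs_zero] at hy
      linarith
  have hδ : Tendsto (fun m : ℕ => 1 / ((m : ℝ) + 1)) atTop (𝓝[>] 0) :=
    tendsto_nhdsWithin_iff.2 ⟨tendsto_one_div_add_atTop_nhds_zero_nat,
      Eventually.of_forall fun m => by
        change (0 : ℝ) < 1 / ((m : ℝ) + 1)
        positivity⟩
  have hthick : Tendsto (fun m : ℕ => volume (thickening (1 / ((m : ℝ) + 1)) S)) atTop
      (𝓝 (volume S)) :=
    (tendsto_measure_thickening_of_isClosed
      ⟨1, one_pos, (hSbdd.thickening.measure_lt_top).ne⟩ hSclosed).comp hδ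
  have hfatou := measure_lt_abs_le_of_tendsto (μ := volume) (g := g) (lam := lam)
    (T := fun m x => ∫ y in {y : E | 1 / ((m : ℝ) + 1) ≤ ‖x - y‖},
      (Ω (x - y) / ‖x - y‖ ^ n) * f y)
    (G := fun m => closedBall 0 ((m : ℝ) + 1))
    (fun x => by
      obtain ⟨j, hj⟩ := exists_nat_ge ‖x‖
      filter_upwards [eventually_ge_atTop j] with m hm
      rw [mem_closedBall_zero_iff]
      have : (j : ℝ) ≤ m := by exact_mod_cast hm
      linarith)
    (hg.mono fun x hx => hx.comp hδ)
    (hthick.add_const _)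
    (fun m => volume_lt_abs_truncated_integral_le hd (by positivity)
      (by
        have : (0 : ℝ) ≤ m := m.cast_nonneg
        rw [div_le_iff₀ (by positivity)]
        nlinarith) hΩ hodd hhom hInt hf hcs hr.le hfr ht0 hlam)
  have hSvol : volume S ≤ ENNReal.ofReal (I / t) := by
    have h := mul_meas_ge_le_integral_of_nonneg (μ := volume) (f := fun x => |f x|)
      (ae_of_all _ fun x => abs_nonneg (f x)) hfi.abs t
    rw [← ENNReal.ofReal_toReal hSbdd.measure_lt_top.ne]
    refine ENNReal.ofReal_le_ofReal ?_
    rw [le_div_iff₀' ht0]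
    exact h
  refine hfatou.trans ?_
  rw [← add_assoc]
  refine add_le_add ((add_le_add hSvol le_rfl).trans ?_) le_rfl
  rw [← ENNReal.ofReal_add (by positivity) (by positivity)]
  refine ENNReal.ofReal_le_ofReal ?_
  have h1 : I / t = (1 + W) * (1 / lam * I) := by
    rw [ht]
    field_simp
  have h2 : (4 * W) ^ 2 * t / (lam / 2) ^ 2 * I = 64 * (W * (W / (1 + W))) * (1 / lam * I) := by
    rw [ht]
    field_simp
    ring
  rw [h1, h2, ← add_mul]
  refine mul_le_mul_of_nonneg_right ?_ (by positivity)
  have h3 : W * (W / (1 + W)) ≤ W * 1 :=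
    mul_le_mul_of_nonneg_left ((div_le_one (by positivity)).2 (by linarith)) hW0
  linarith

end homogeneousKernel

/-- Reduction of the weak-type (1,1) inequality to finite nonnegative
combinations of Dirac masses, for singular integral operators with kernel
`K(x) = Ω(x)/|x|^n`, where `Ω` is odd, homogeneous of degree zero, has mean
zero on the sphere, and satisfies a Hörmander-type smoothness condition with
constant `A n δ`. -/
theorem weak_type_reduction_to_diracs_general :
    ∀ A : ℝ, 1 ≤ A → ∃ C₄ C₅ : ℝ, 0 < C₄ ∧ 0 < C₅ ∧
      ∀ (n : ℕ), 2 ≤ n →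
      ∀ Ω : EuclideanSpace ℝ (Fin n) → ℝ, Measurable Ω →
      (∀ x : EuclideanSpace ℝ (Fin n), x ≠ 0 → Ω (-x) = -Ω x) →
      (∀ (x : EuclideanSpace ℝ (Fin n)), x ≠ 0 → ∀ δ : ℝ, 0 < δ → Ω (δ • x) = Ω x) →
      Integrable (fun θ : sphere (0 : EuclideanSpace ℝ (Fin n)) 1 => Ω θ)
        (volume : Measure (EuclideanSpace ℝ (Fin n))).toSphere →
      (∫ θ : sphere (0 : EuclideanSpace ℝ (Fin n)) 1, Ω θ
          ∂(volume : Measure (EuclideanSpace ℝ (Fin n))).toSphere) = 0 →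
      (∀ ξ : EuclideanSpace ℝ (Fin n), ‖ξ‖ = 1 → ∀ δ : ℝ, 0 < δ → δ < 1 / n →
        (∫ θ : sphere (0 : EuclideanSpace ℝ (Fin n)) 1, |Ω ((θ : EuclideanSpace ℝ (Fin n)) - δ • ξ) - Ω θ|
            ∂(volume : Measure (EuclideanSpace ℝ (Fin n))).toSphere) ≤
          A * n * δ * ∫ θ : sphere (0 : EuclideanSpace ℝ (Fin n)) 1, |Ω θ|
            ∂(volume : Measure (EuclideanSpace ℝ (Fin n))).toSphere) →
      ∀ lam : ℝ, 0 < lam →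
      ∀ f : EuclideanSpace ℝ (Fin n) → ℝ, Continuous f → HasCompactSupport f →
      ∀ g : EuclideanSpace ℝ (Fin n) → ℝ, Measurable g →
      (∀ᵐ x ∂(volume : Measure (EuclideanSpace ℝ (Fin n))),
        Tendsto (fun ε : ℝ =>
            ∫ y in {y : EuclideanSpace ℝ (Fin n) | ε ≤ ‖x - y‖},
              (Ω (x - y) / ‖x - y‖ ^ n) * f y)
          (nhdsWithin 0 (Set.Ioi 0)) (nhds (g x))) →
      volume {x : EuclideanSpace ℝ (Fin n) | lam < |g x|} ≤
        ENNReal.ofReal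
          ((C₄ + C₅ * ∫ θ : sphere (0 : EuclideanSpace ℝ (Fin n)) 1, |Ω θ|
              ∂(volume : Measure (EuclideanSpace ℝ (Fin n))).toSphere) *
            ((1 / lam) * ∫ x, |f x|)) +
        2 * ⨆ (N : ℕ) (c : Fin N → EuclideanSpace ℝ (Fin n)) (a : Fin N → ℝ)
              (_ : ∀ k, 0 < a k) (_ : ∑ k, a k ≤ 16 * ∫ x, |f x|),
            volume {x : EuclideanSpace ℝ (Fin n) |
              lam < |∑ k, a k * (Ω (x - c k) / ‖x - c k‖ ^ n)|} := by
  intro A _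
  refine ⟨1, 65, by norm_num, by norm_num, ?_⟩
  intro n hn Ω hΩ hodd hhom hInt _ _ lam hlam f hf hcs g _ hg
  have : Nonempty (Fin n) := ⟨⟨0, by omega⟩⟩
  exact volume_lt_abs_le_add_diracDistribSup finrank_euclideanSpace_fin hΩ hodd hhom hInt hlam
    hf hcs hg
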